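/- Let H be a finite-dimensional real inner product space, ‖·‖♯ a norm on H with dual norm ‖·‖♦, and Φ : H → ℝ^M linear. Let λ > 0, x♮ ∈ H, and ω ∈ ℝ^M with ‖Φᵀω‖♦ ≤ λ. If x* ∈ H satisfies the constraint ‖Φᵀ(Φx* − (Φx♮ + ω))‖♦ ≤ λ, then with z = x* − x♮ one has ‖ΦᵀΦz‖♦ ≤ 2λ and ‖Φz‖₂² ≤ 2λ‖z‖♯. -/

import Mathlib

noncomputable section

open scoped RealInnerProductSpace

variable {H : Type*} [NormedAddCommGroup H] [InnerProductSpace ℝ H] [FiniteDimensional ℝ H]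

/-- `sharp` is a norm on `H`. -/
structure IsNormOn (sharp : H → ℝ) : Prop where
  triangle : ∀ x y : H, sharp (x + y) ≤ sharp x + sharp y
  smul_eq : ∀ (c : ℝ) (x : H), sharp (c • x) = |c| * sharp x
  eq_zero_of : ∀ x : H, sharp x = 0 → x = 0

/-- The dual norm of `sharp`: `‖u‖♦ = sup {|⟨u,v⟩| : ‖v‖♯ ≤ 1}`. -/
def dualNorm (sharp : H → ℝ) (u : H) : ℝ :=
  sSup {r : ℝ | ∃ v : H, sharp v ≤ 1 ∧ r = |⟪u, v⟫|}

/-- The subdifferential of `f` at `x`. -/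
def subdiff (f : H → ℝ) (x : H) : Set H :=
  {u : H | ∀ y : H, f y ≥ f x + ⟪u, y - x⟫}

/-- `(H, A, sharp)` is a compressed sensing space with bound `L`. -/
structure IsCSSpace (A : Set H) (sharp : H → ℝ) (L : ℝ) : Prop where
  zero_mem : (0 : H) ∈ A
  decomp : ∀ a ∈ A, ∀ v : H, ∃ z₁ z₂ : H, v = z₁ + z₂ ∧
    sharp (a + z₁) = sharp a + sharp z₁ ∧ sharp z₂ ≤ L * ‖v‖

/-- `Φ` satisfies the `(ρ, α)`-robust width property over the unit `sharp`-ball. -/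
def RobustWidth {M : ℕ} (Φ : H →ₗ[ℝ] EuclideanSpace ℝ (Fin M)) (sharp : H → ℝ)
    (ρ α : ℝ) : Prop :=
  ∀ x : H, ‖Φ x‖ < α * ‖x‖ → ‖x‖ ≤ ρ * sharp x

theorem LinearMap.exists_bound_of_norm {E : Type*} [AddCommGroup E] [Module ℝ E]
    [FiniteDimensional ℝ E] (p : Seminorm ℝ E) (hp : ∀ x, p x = 0 → x = 0) (f : E →ₗ[ℝ] ℝ) :
    ∃ C, ∀ v, |f v| ≤ C * p v := by
  let _ : Norm E := ⟨p⟩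
  have core : NormedSpace.Core ℝ E :=
    { norm_nonneg := apply_nonneg p
      norm_smul := map_smul_eq_mul p
      norm_triangle := map_add_le_add p
      norm_eq_zero_iff := fun x => ⟨hp x, by rintro rfl; exact map_zero p⟩ }
  let _ : NormedAddCommGroup E := NormedAddCommGroup.ofCore core
  let _ : NormedSpace ℝ E := NormedSpace.ofCore core
  exact ⟨‖f.toContinuousLinearMap‖, f.toContinuousLinearMap.le_opNorm⟩

namespace IsNormOn

variable {sharp : H → ℝ}

/-- The seminorm bundled from `IsNormOn`. -/
def toSeminorm (hs : IsNormOn sharp) : Seminorm ℝ H :=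
  Seminorm.of sharp hs.triangle hs.smul_eq

omit [FiniteDimensional ℝ H] in
theorem nonneg (hs : IsNormOn sharp) (x : H) : 0 ≤ sharp x :=
  apply_nonneg hs.toSeminorm x

omit [FiniteDimensional ℝ H] in
theorem map_zero (hs : IsNormOn sharp) : sharp 0 = 0 :=
  _root_.map_zero hs.toSeminorm

theorem bddAbove_dualNorm (hs : IsNormOn sharp) (u : H) :
    BddAbove {r : ℝ | ∃ v : H, sharp v ≤ 1 ∧ r = |⟪u, v⟫|} := by
  obtain ⟨C, hC⟩ := LinearMap.exists_bound_of_norm hs.toSeminorm hs.eq_zero_of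
    (innerₛₗ ℝ u)
  refine ⟨|C|, ?_⟩
  rintro _ ⟨v, hv, rfl⟩
  calc |⟪u, v⟫| ≤ C * sharp v := hC v
    _ ≤ |C| * sharp v := mul_le_mul_of_nonneg_right (le_abs_self C) (hs.nonneg v)
    _ ≤ |C| := mul_le_of_le_one_right (abs_nonneg C) hv

theorem abs_inner_le_dualNorm (hs : IsNormOn sharp) (u : H) {v : H} (hv : sharp v ≤ 1) :
    |⟪u, v⟫| ≤ dualNorm sharp u :=
  le_csSup (hs.bddAbove_dualNorm u) ⟨v, hv, rfl⟩

omit [FiniteDimensional ℝ H] in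
theorem dualNorm_le (hs : IsNormOn sharp) {u : H} {c : ℝ}
    (h : ∀ v, sharp v ≤ 1 → |⟪u, v⟫| ≤ c) : dualNorm sharp u ≤ c := by
  refine csSup_le ⟨_, 0, by rw [hs.map_zero]; exact zero_le_one, rfl⟩ ?_
  rintro _ ⟨v, hv, rfl⟩
  exact h v hv

theorem dualNorm_add_le (hs : IsNormOn sharp) (u w : H) :
    dualNorm sharp (u + w) ≤ dualNorm sharp u + dualNorm sharp w := by
  refine hs.dualNorm_le fun v hv => ?_
  rw [inner_add_left]
  exact (abs_add_le _ _).trans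
    (add_le_add (hs.abs_inner_le_dualNorm u hv) (hs.abs_inner_le_dualNorm w hv))

theorem abs_inner_le_dualNorm_mul (hs : IsNormOn sharp) (u v : H) :
    |⟪u, v⟫| ≤ dualNorm sharp u * sharp v := by
  rcases (hs.nonneg v).eq_or_lt with h | h
  · simp [hs.eq_zero_of v h.symm, hs.map_zero]
  · have hv : sharp ((sharp v)⁻¹ • v) ≤ 1 := by
      rw [hs.smul_eq, abs_of_pos (inv_pos.2 h), inv_mul_cancel₀ h.ne']
    have := hs.abs_inner_le_dualNorm u hv
    rwa [inner_smul_right, abs_mul, abs_of_pos (inv_pos.2 h), inv_mul_le_iff₀ h,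
      mul_comm] at this

end IsNormOn

theorem dantzig_feasible_bounds {M : ℕ} (sharp : H → ℝ) (hs : IsNormOn sharp)
    (Φ : H →ₗ[ℝ] EuclideanSpace ℝ (Fin M))
    (lam : ℝ) (hlam : 0 < lam)
    (xnat : H) (ω : EuclideanSpace ℝ (Fin M))
    (hω : dualNorm sharp ((LinearMap.adjoint Φ) ω) ≤ lam)
    (xstar : H)
    (hfeas : dualNorm sharp ((LinearMap.adjoint Φ) (Φ xstar - (Φ xnat + ω))) ≤ lam)
    (z : H) (hz : z = xstar - xnat) :
    dualNorm sharp ((LinearMap.adjoint Φ) (Φ z)) ≤ 2 * lam ∧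
      ‖Φ z‖ ^ 2 ≤ 2 * lam * sharp z := by
  have hdual : dualNorm sharp ((LinearMap.adjoint Φ) (Φ z)) ≤ 2 * lam := by
    have hsplit : (LinearMap.adjoint Φ) (Φ z) =
        (LinearMap.adjoint Φ) (Φ xstar - (Φ xnat + ω)) + (LinearMap.adjoint Φ) ω := by
      rw [hz, ← map_add, map_sub]
      congr 1
      abel
    rw [hsplit]
    linarith [hs.dualNorm_add_le ((LinearMap.adjoint Φ) (Φ xstar - (Φ xnat + ω)))
      ((LinearMap.adjoint Φ) ω)]
  refine ⟨hdual, ?_⟩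
  calc ‖Φ z‖ ^ 2 = ⟪(LinearMap.adjoint Φ) (Φ z), z⟫ := by
        rw [LinearMap.adjoint_inner_left, real_inner_self_eq_norm_sq]
    _ ≤ |⟪(LinearMap.adjoint Φ) (Φ z), z⟫| := le_abs_self _
    _ ≤ dualNorm sharp ((LinearMap.adjoint Φ) (Φ z)) * sharp z :=
        hs.abs_inner_le_dualNorm_mul _ _
    _ ≤ 2 * lam * sharp z := mul_le_mul_of_nonneg_right hdual (hs.nonneg z)
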